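/- arXiv:0803.3480 — 2 statements merged into one kernel-verified Lean document; each statement's English description precedes it below -/
import Mathlib

section
/- Let Ω ⊆ H be an open set disjoint from the real axis and let f = u + ιv be hyperholomorphic on Ω with f(p) ≠ 0 for every p ∈ Ω. Then the function p ↦ f(p)⁻¹ (the pointwise quaternionic multiplicative inverse, which is complex-like with decomposition u/(u²+v²) + ι·(−v/(u²+v²))) is hyperholomorphic on Ω. -/
open Quaternion MeasureTheory

noncomputable section

/-- `r(p)` : distance from the real axis. -/
def rr (p : ℍ[ℝ]) : ℝ := Real.sqrt (p.imI ^ 2 + p.imJ ^ 2 + p.imK ^ 2)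

def qi : ℍ[ℝ] := ⟨0, 1, 0, 0⟩
def qj : ℍ[ℝ] := ⟨0, 0, 1, 0⟩
def qk : ℍ[ℝ] := ⟨0, 0, 0, 1⟩

/-- imaginary part of a quaternion -/
def qim (p : ℍ[ℝ]) : ℍ[ℝ] := ⟨0, p.imI, p.imJ, p.imK⟩

/-- `ι(p)` -/
def iota (p : ℍ[ℝ]) : ℍ[ℝ] := (rr p)⁻¹ • qim p

/-- left Fueter operator -/
def Dl (f : ℍ[ℝ] → ℍ[ℝ]) (p : ℍ[ℝ]) : ℍ[ℝ] :=
  fderiv ℝ f p 1 + qi * fderiv ℝ f p qi + qj * fderiv ℝ f p qj + qk * fderiv ℝ f p qk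

/-- right Fueter operator -/
def Dr (f : ℍ[ℝ] → ℍ[ℝ]) (p : ℍ[ℝ]) : ℍ[ℝ] :=
  fderiv ℝ f p 1 + fderiv ℝ f p qi * qi + fderiv ℝ f p qj * qj + fderiv ℝ f p qk * qk

/-- hyperholomorphic on `Ω` with decomposition `f = u + ι v` -/
def Hyperholo (Ω : Set ℍ[ℝ]) (f : ℍ[ℝ] → ℍ[ℝ]) (u v : ℍ[ℝ] → ℝ) : Prop :=
  (∀ p ∈ Ω, DifferentiableAt ℝ f p) ∧
  (∀ p ∈ Ω, f p = (u p : ℍ[ℝ]) + iota p * (v p : ℍ[ℝ])) ∧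
  (∀ p ∈ Ω, Dl f p = ((-2 * v p / rr p : ℝ) : ℍ[ℝ]))

/-- spherical parametrization of the imaginary unit sphere -/
def iotaSph (α β : ℝ) : ℍ[ℝ] :=
  ⟨0, Real.cos α * Real.sin β, Real.sin α * Real.sin β, Real.cos β⟩

/-- the point `t + r·ι(α,β)` -/
def pt (t r α β : ℝ) : ℍ[ℝ] := (t : ℍ[ℝ]) + (r : ℍ[ℝ]) * iotaSph α β

@[simp] lemma qi_re : qi.re = 0 := rfl
@[simp] lemma qi_imI : qi.imI = 1 := rfl
@[simp] lemma qi_imJ : qi.imJ = 0 := rfl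
@[simp] lemma qi_imK : qi.imK = 0 := rfl
@[simp] lemma qj_re : qj.re = 0 := rfl
@[simp] lemma qj_imI : qj.imI = 0 := rfl
@[simp] lemma qj_imJ : qj.imJ = 1 := rfl
@[simp] lemma qj_imK : qj.imK = 0 := rfl
@[simp] lemma qk_re : qk.re = 0 := rfl
@[simp] lemma qk_imI : qk.imI = 0 := rfl
@[simp] lemma qk_imJ : qk.imJ = 0 := rfl
@[simp] lemma qk_imK : qk.imK = 1 := rfl
@[simp] lemma qim_re (p : ℍ[ℝ]) : (qim p).re = 0 := rfl
@[simp] lemma qim_imI (p : ℍ[ℝ]) : (qim p).imI = p.imI := rfl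
@[simp] lemma qim_imJ (p : ℍ[ℝ]) : (qim p).imJ = p.imJ := rfl
@[simp] lemma qim_imK (p : ℍ[ℝ]) : (qim p).imK = p.imK := rfl
@[simp] lemma iota_re (p : ℍ[ℝ]) : (iota p).re = 0 := by simp [iota]
@[simp] lemma iota_imI (p : ℍ[ℝ]) : (iota p).imI = (rr p)⁻¹ * p.imI := by simp [iota]
@[simp] lemma iota_imJ (p : ℍ[ℝ]) : (iota p).imJ = (rr p)⁻¹ * p.imJ := by simp [iota]
@[simp] lemma iota_imK (p : ℍ[ℝ]) : (iota p).imK = (rr p)⁻¹ * p.imK := by simp [iota]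

/-- The `ℝ`-linear map `qim`, as a continuous linear map. -/
def qimCLM : ℍ[ℝ] →L[ℝ] ℍ[ℝ] :=
  LinearMap.toContinuousLinearMap
    { toFun := qim
      map_add' := fun a b => by ext <;> simp
      map_smul' := fun c a => by ext <;> simp }

/-- The real part, as a continuous linear map. -/
def reCLM : ℍ[ℝ] →L[ℝ] ℝ :=
  LinearMap.toContinuousLinearMap
    { toFun := fun a => a.re
      map_add' := fun a b => by simp
      map_smul' := fun c a => by simp }

/-- The coordinate `imI`, as a continuous linear map. -/
def imICLM : ℍ[ℝ] →L[ℝ] ℝ :=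
  LinearMap.toContinuousLinearMap
    { toFun := fun a => a.imI
      map_add' := fun a b => by simp
      map_smul' := fun c a => by simp }

/-- The coordinate `imJ`, as a continuous linear map. -/
def imJCLM : ℍ[ℝ] →L[ℝ] ℝ :=
  LinearMap.toContinuousLinearMap
    { toFun := fun a => a.imJ
      map_add' := fun a b => by simp
      map_smul' := fun c a => by simp }

/-- The coordinate `imK`, as a continuous linear map. -/
def imKCLM : ℍ[ℝ] →L[ℝ] ℝ :=
  LinearMap.toContinuousLinearMap
    { toFun := fun a => a.imK
      map_add' := fun a b => by simp
      map_smul' := fun c a => by simp }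

lemma sum_sq_pos {p : ℍ[ℝ]} (hp : qim p ≠ 0) : 0 < p.imI ^ 2 + p.imJ ^ 2 + p.imK ^ 2 := by
  by_contra h
  apply hp
  have hI : p.imI = 0 := by
    nlinarith [sq_nonneg p.imI, sq_nonneg p.imJ, sq_nonneg p.imK]
  have hJ : p.imJ = 0 := by
    nlinarith [sq_nonneg p.imI, sq_nonneg p.imJ, sq_nonneg p.imK]
  have hK : p.imK = 0 := by
    nlinarith [sq_nonneg p.imI, sq_nonneg p.imJ, sq_nonneg p.imK]
  ext <;> simp [hI, hJ, hK]

lemma rr_pos {p : ℍ[ℝ]} (hp : qim p ≠ 0) : 0 < rr p := Real.sqrt_pos.2 (sum_sq_pos hp)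

lemma rr_sq (p : ℍ[ℝ]) : rr p ^ 2 = p.imI ^ 2 + p.imJ ^ 2 + p.imK ^ 2 :=
  Real.sq_sqrt (by positivity)

lemma iota_mul_self {p : ℍ[ℝ]} (hp : qim p ≠ 0) : iota p * iota p = -1 := by
  have h := rr_sq p
  have hr := (rr_pos hp).ne'
  ext
  · simp
    field_simp
    linarith
  all_goals simp
  all_goals ring

/-- The derivative of `iota` off the real axis. -/
lemma exists_hasFDerivAt_iota {p : ℍ[ℝ]} (hp : qim p ≠ 0) :
    ∃ L : ℍ[ℝ] →L[ℝ] ℍ[ℝ], HasFDerivAt iota L p ∧ ∀ w, L w = (rr p)⁻¹ • qim w -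
      ((p.imI * w.imI + p.imJ * w.imJ + p.imK * w.imK) / rr p ^ 3) • qim p := by
  have hr := (rr_pos hp).ne'
  have h1 := (((imICLM.hasFDerivAt (x := p)).pow 2).add ((imJCLM.hasFDerivAt (x := p)).pow 2)).add
    ((imKCLM.hasFDerivAt (x := p)).pow 2)
  have h2 := h1.sqrt (sum_sq_pos hp).ne'
  have h3 := (hasDerivAt_inv hr).comp_hasFDerivAt p h2
  have h4 := h3.smul (qimCLM.hasFDerivAt (x := p))
  refine ⟨_, h4, fun w => ?_⟩
  have e1 : ∀ w, qimCLM w = qim w := fun _ => rfl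
  have e2 : ∀ w, imICLM w = w.imI := fun _ => rfl
  have e3 : ∀ w, imJCLM w = w.imJ := fun _ => rfl
  have e4 : ∀ w, imKCLM w = w.imK := fun _ => rfl
  have e5 : √(p.imI ^ 2 + p.imJ ^ 2 + p.imK ^ 2) = rr p := rfl
  simp [e1, e2, e3, e4, e5]
  rw [sub_eq_add_neg, ← neg_smul]
  congr 2
  field_simp
  ring

/-- The gradient of a real function, given by its differential, as a quaternion. -/
def qgrad (L : ℍ[ℝ] →L[ℝ] ℝ) : ℍ[ℝ] := ⟨L 1, L qi, L qj, L qk⟩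

@[simp] lemma qgrad_re (L : ℍ[ℝ] →L[ℝ] ℝ) : (qgrad L).re = L 1 := rfl
@[simp] lemma qgrad_imI (L : ℍ[ℝ] →L[ℝ] ℝ) : (qgrad L).imI = L qi := rfl
@[simp] lemma qgrad_imJ (L : ℍ[ℝ] →L[ℝ] ℝ) : (qgrad L).imJ = L qj := rfl
@[simp] lemma qgrad_imK (L : ℍ[ℝ] →L[ℝ] ℝ) : (qgrad L).imK = L qk := rfl

lemma qgrad_smul_add_smul (a b : ℝ) (L M : ℍ[ℝ] →L[ℝ] ℝ) :
    qgrad (a • L + b • M) = a • qgrad L + b • qgrad M := by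
  ext <;> simp

/-- The left Fueter operator on a complex-like function. -/
lemma Dl_eq_of_eventuallyEq {f : ℍ[ℝ] → ℍ[ℝ]} {u v : ℍ[ℝ] → ℝ} {u' v' : ℍ[ℝ] →L[ℝ] ℝ}
    {p : ℍ[ℝ]} (hp : qim p ≠ 0) (hu : HasFDerivAt u u' p) (hv : HasFDerivAt v v' p)
    (hf : f =ᶠ[nhds p] fun q => (u q : ℍ[ℝ]) + iota q * (v q : ℍ[ℝ])) :
    Dl f p = ((-2 * v p / rr p : ℝ) : ℍ[ℝ]) + (qgrad u' + qgrad v' * iota p) := by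
  obtain ⟨L, hL, hLw⟩ := exists_hasFDerivAt_iota hp
  have h1 : HasFDerivAt (fun q => u q • (1 : ℍ[ℝ]) + v q • iota q) _ p :=
    (hu.smul_const (1 : ℍ[ℝ])).add (hv.smul hL)
  have h2 : f =ᶠ[nhds p] fun q => u q • (1 : ℍ[ℝ]) + v q • iota q := by
    filter_upwards [hf] with q hq
    rw [hq, Quaternion.mul_coe_eq_smul, ← Quaternion.coe_mul_eq_smul (u q), mul_one]
  have hr := (rr_pos hp).ne'
  have hs := rr_sq p
  have hF (w : ℍ[ℝ]) : fderiv ℝ f p w = u' w • 1 + (v p • ((rr p)⁻¹ • qim w -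
      ((p.imI * w.imI + p.imJ * w.imJ + p.imK * w.imK) / rr p ^ 3) • qim p) + v' w • iota p) := by
    rw [(h1.congr_of_eventuallyEq h2).fderiv, ← hLw]
    rfl
  simp only [Dl, hF]
  ext
  · simp only [Quaternion.re_add, Quaternion.re_coe]
    simp
    field_simp
    linear_combination (-v p) * hs
  all_goals simp only [Quaternion.imI_add, Quaternion.imJ_add, Quaternion.imK_add,
    Quaternion.imI_coe, Quaternion.imJ_coe, Quaternion.imK_coe]
  all_goals simp
  all_goals field_simp
  all_goals ring

lemma complexLike_inv {ι : ℍ[ℝ]} (hι : ι * ι = -1) {a b : ℝ} (h : a ^ 2 + b ^ 2 ≠ 0) :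
    ((a : ℍ[ℝ]) + ι * b)⁻¹ =
      ((a / (a ^ 2 + b ^ 2) : ℝ) : ℍ[ℝ]) + ι * ((-b / (a ^ 2 + b ^ 2) : ℝ) : ℍ[ℝ]) := by
  apply inv_eq_of_mul_eq_one_right
  simp only [Quaternion.mul_coe_eq_smul]
  rw [← mul_one ((a / (a ^ 2 + b ^ 2) : ℝ) : ℍ[ℝ]), ← mul_one (a : ℍ[ℝ]),
    Quaternion.coe_mul_eq_smul, Quaternion.coe_mul_eq_smul]
  simp only [add_mul, mul_add, smul_mul_smul_comm, hι, mul_one, one_mul]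
  have : (1 : ℍ[ℝ]) = ((a ^ 2 + b ^ 2) / (a ^ 2 + b ^ 2)) • (1 : ℍ[ℝ]) := by
    rw [div_self h, one_smul]
  conv_rhs => rw [this]
  module

lemma sq_add_sq_ne_zero {ι : ℍ[ℝ]} {a b : ℝ} (h : (a : ℍ[ℝ]) + ι * b ≠ 0) :
    a ^ 2 + b ^ 2 ≠ 0 := by
  intro h0
  have ha : a = 0 := by nlinarith [sq_nonneg a, sq_nonneg b]
  have hb : b = 0 := by nlinarith [sq_nonneg a, sq_nonneg b]
  simp [ha, hb] at h

/-- The pointwise quaternionic inverse of a non-vanishing hyperholomorphic function is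
hyperholomorphic. -/
theorem hyperholo_inv (Ω : Set ℍ[ℝ]) (hΩ : IsOpen Ω)
    (hax : ∀ p ∈ Ω, qim p ≠ 0)
    (f : ℍ[ℝ] → ℍ[ℝ]) (u v : ℍ[ℝ] → ℝ)
    (hf : Hyperholo Ω f u v) (hne : ∀ p ∈ Ω, f p ≠ 0) :
    Hyperholo Ω (fun p => (f p)⁻¹) (fun p => u p / (u p ^ 2 + v p ^ 2))
      (fun p => -v p / (u p ^ 2 + v p ^ 2)) := by
  obtain ⟨hd, hdec, hD⟩ := hf
  have hn : ∀ p ∈ Ω, u p ^ 2 + v p ^ 2 ≠ 0 := fun p hp =>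
    sq_add_sq_ne_zero (hdec p hp ▸ hne p hp)
  have hdec' : ∀ p ∈ Ω, (f p)⁻¹ = ((u p / (u p ^ 2 + v p ^ 2) : ℝ) : ℍ[ℝ]) +
      iota p * ((-v p / (u p ^ 2 + v p ^ 2) : ℝ) : ℍ[ℝ]) := fun p hp => by
    rw [hdec p hp, complexLike_inv (iota_mul_self (hax p hp)) (hn p hp)]
  refine ⟨fun p hp => (hd p hp).inv (hne p hp), hdec', fun p hp => ?_⟩
  have hΩp := hΩ.mem_nhds hp
  obtain ⟨L, hL, -⟩ := exists_hasFDerivAt_iota (hax p hp)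
  have hu : DifferentiableAt ℝ u p := by
    refine ((reCLM.differentiableAt).comp p (hd p hp)).congr_of_eventuallyEq ?_
    filter_upwards [hΩp] with q hq
    change u q = (f q).re
    rw [hdec q hq]
    simp
  have hv : DifferentiableAt ℝ v p := by
    refine ((reCLM.differentiableAt).comp p
      (hL.differentiableAt.mul (hd p hp))).neg.congr_of_eventuallyEq ?_
    filter_upwards [hΩp] with q hq
    change v q = -(iota q * f q).re
    rw [hdec q hq, mul_add, ← mul_assoc, iota_mul_self (hax q hq)]
    simp
  have hu := hu.hasFDerivAt
  have hv := hv.hasFDerivAt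
  set u' := fderiv ℝ u p
  set v' := fderiv ℝ v p
  have hCR : qgrad u' + qgrad v' * iota p = 0 := by
    have := Dl_eq_of_eventuallyEq (hax p hp) hu hv (by filter_upwards [hΩp] with q hq using hdec q hq)
    rw [hD p hp] at this
    simpa using this
  have hi := (hasDerivAt_inv (hn p hp)).comp_hasFDerivAt p ((hu.pow 2).add (hv.pow 2))
  have hn := hn p hp
  set a := (v p ^ 2 - u p ^ 2) / (u p ^ 2 + v p ^ 2) ^ 2 with ha
  set b := 2 * u p * v p / (u p ^ 2 + v p ^ 2) ^ 2 with hb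
  have hU : HasFDerivAt (fun q => u q / (u q ^ 2 + v q ^ 2)) (a • u' + (-b) • v') p := by
    refine HasFDerivAt.congr_fderiv (hu.mul hi) ?_
    ext w
    simp [ha, hb]
    field_simp
    ring
  have hV : HasFDerivAt (fun q => -v q / (u q ^ 2 + v q ^ 2)) (b • u' + a • v') p := by
    refine HasFDerivAt.congr_fderiv (hv.neg.mul hi) ?_
    ext w
    simp [ha, hb]
    field_simp
    ring
  rw [Dl_eq_of_eventuallyEq (hax p hp) hU hV
    (by filter_upwards [hΩp] with q hq using hdec' q hq), add_eq_left,
    qgrad_smul_add_smul, qgrad_smul_add_smul, eq_neg_of_add_eq_zero_left hCR]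
  simp only [add_mul, smul_mul_assoc, neg_mul, mul_assoc, iota_mul_self (hax p hp), mul_neg,
    mul_one]
  module
end
end

section
/- (Spherical form of the Fueter operator.) Let f : H → H be ℝ-differentiable at a point p = t + r·ι(α,β) with r > 0 and sin β ≠ 0. Define the coordinate derivatives ∂_t f(p), ∂_r f(p) := (d/ds)|_{s=r} f(t + s·ι(α,β)), ∂_α f(p) := (d/ds)|_{s=α} f(t + r·ι(s,β)), and ∂_β f(p) := (d/ds)|_{s=β} f(t + r·ι(α,s)). Then (D_l f)(p) = ∂_t f(p) + ι(α,β)·∂_r f(p) − (1/r)·[(ι_α)⁻¹·∂_α f(p) + (ι_β)⁻¹·∂_β f(p)], where ι_α = ∂ι/∂α(α,β) and ι_β = ∂ι/∂β(α,β) are purely imaginary quaternions, invertible when sin β ≠ 0. -/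
open Quaternion MeasureTheory

noncomputable section

/-- the partial derivative of ι(α,β) with respect to α -/
def iotaA (α β : ℝ) : ℍ[ℝ] :=
  ⟨0, -(Real.sin α * Real.sin β), Real.cos α * Real.sin β, 0⟩

/-- the partial derivative of ι(α,β) with respect to β -/
def iotaB (α β : ℝ) : ℍ[ℝ] :=
  ⟨0, Real.cos α * Real.cos β, Real.sin α * Real.cos β, -Real.sin β⟩

theorem mk_zero_eq_smul (x y z : ℝ) : (⟨0, x, y, z⟩ : ℍ[ℝ]) = x • qi + y • qj + z • qk := by
  ext <;>
    simp only [Quaternion.re_add, Quaternion.imI_add, Quaternion.imJ_add, Quaternion.imK_add,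
      Quaternion.re_smul, Quaternion.imI_smul, Quaternion.imJ_smul, Quaternion.imK_smul] <;>
    simp [qi, qj, qk]

theorem pt_eq (t r α β : ℝ) : pt t r α β = t • (1 : ℍ[ℝ]) + r • iotaSph α β := by
  rw [pt, Quaternion.coe_mul_eq_smul, ← Algebra.algebraMap_eq_smul_one, Quaternion.algebraMap_def]

theorem iotaSph_eq (α β : ℝ) :
    iotaSph α β =
      (Real.cos α * Real.sin β) • qi + (Real.sin α * Real.sin β) • qj + Real.cos β • qk :=
  mk_zero_eq_smul _ _ _

theorem iotaA_eq (α β : ℝ) :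
    iotaA α β = Real.sin β • (-Real.sin α • qi + Real.cos α • qj) := by
  rw [iotaA, mk_zero_eq_smul]
  module

theorem iotaB_eq (α β : ℝ) :
    iotaB α β =
      (Real.cos α * Real.cos β) • qi + (Real.sin α * Real.cos β) • qj + -Real.sin β • qk :=
  mk_zero_eq_smul _ _ _

theorem hasDerivAt_iotaSph_left (α β : ℝ) :
    HasDerivAt (fun s => iotaSph s β) (iotaA α β) α := by
  simp only [iotaSph_eq]
  refine (((((Real.hasDerivAt_cos α).mul_const (Real.sin β)).smul_const qi).add
    (((Real.hasDerivAt_sin α).mul_const (Real.sin β)).smul_const qj)).add_const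
    (Real.cos β • qk)).congr_deriv ?_
  rw [iotaA_eq]
  module

theorem hasDerivAt_iotaSph_right (α β : ℝ) :
    HasDerivAt (fun s => iotaSph α s) (iotaB α β) β := by
  simp only [iotaSph_eq, iotaB_eq]
  exact ((((Real.hasDerivAt_sin β).const_mul (Real.cos α)).smul_const qi).add
    (((Real.hasDerivAt_sin β).const_mul (Real.sin α)).smul_const qj)).add
    ((Real.hasDerivAt_cos β).smul_const qk)

theorem iotaA_inv (α β : ℝ) : (iotaA α β)⁻¹ = -((Real.sin β ^ 2)⁻¹ • iotaA α β) := by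
  have hn : Quaternion.normSq (iotaA α β) = Real.sin β ^ 2 := by
    rw [Quaternion.normSq_def', iotaA]
    linear_combination Real.sin β ^ 2 * Real.sin_sq_add_cos_sq α
  have hs : star (iotaA α β) = -iotaA α β := by
    rw [Quaternion.star_eq_neg]
    rfl
  rw [Quaternion.inv_def, hn, hs, smul_neg]

theorem iotaB_inv (α β : ℝ) : (iotaB α β)⁻¹ = -iotaB α β := by
  have hn : Quaternion.normSq (iotaB α β) = 1 := by
    rw [Quaternion.normSq_def', iotaB]
    linear_combination Real.cos β ^ 2 * Real.sin_sq_add_cos_sq α + Real.sin_sq_add_cos_sq β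
  have hs : star (iotaB α β) = -iotaB α β := by
    rw [Quaternion.star_eq_neg]
    rfl
  rw [Quaternion.inv_def, hn, hs, inv_one, one_smul]

/-- The vectors `ι`, `ι_α / sin β`, `ι_β` form an orthonormal basis of the imaginary quaternions,
so the spatial part of the Fueter operator may be computed in it. -/
theorem sum_basis_mul_map_eq_sum_spherical (L : ℍ[ℝ] →L[ℝ] ℍ[ℝ]) (α : ℝ) {β : ℝ}
    (hβ : Real.sin β ≠ 0) :
    qi * L qi + qj * L qj + qk * L qk =
      iotaSph α β * L (iotaSph α β) + (Real.sin β ^ 2)⁻¹ • (iotaA α β * L (iotaA α β))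
        + iotaB α β * L (iotaB α β) := by
  have hα := Real.sin_sq_add_cos_sq α
  have hb := Real.sin_sq_add_cos_sq β
  have hA : (Real.sin β ^ 2)⁻¹ • (iotaA α β * L (iotaA α β)) =
      (-Real.sin α • qi + Real.cos α • qj) * L (-Real.sin α • qi + Real.cos α • qj) := by
    rw [iotaA_eq, map_smul, smul_mul_smul_comm, smul_smul, ← sq,
      inv_mul_cancel₀ (pow_ne_zero 2 hβ), one_smul]
  rw [hA, iotaSph_eq, iotaB_eq]
  simp only [map_add, map_smul, mul_add, add_mul, smul_mul_smul_comm]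
  linear_combination (norm := module)
    (-(1 : ℝ)) • (hα • (qi * L qi + qj * L qj) + hb • (qk * L qk)
      + hb • ((Real.cos α ^ 2) • (qi * L qi) + (Real.sin α ^ 2) • (qj * L qj)
        + (Real.cos α * Real.sin α) • (qi * L qj + qj * L qi)))

/-- Spherical form of the left Fueter operator. -/
theorem fueter_spherical (f : ℍ[ℝ] → ℍ[ℝ]) (t r α β : ℝ)
    (hr : 0 < r) (hβ : Real.sin β ≠ 0)
    (hdiff : DifferentiableAt ℝ f (pt t r α β)) :
    Dl f (pt t r α β) =
      deriv (fun s => f (pt s r α β)) t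
        + iotaSph α β * deriv (fun s => f (pt t s α β)) r
        - r⁻¹ • ((iotaA α β)⁻¹ * deriv (fun s => f (pt t r s β)) α
                  + (iotaB α β)⁻¹ * deriv (fun s => f (pt t r α s)) β) := by
  have hL := hdiff.hasFDerivAt
  have ht : HasDerivAt (fun s => pt s r α β) 1 t := by
    simp only [pt_eq]
    simpa using ((hasDerivAt_id t).smul_const (1 : ℍ[ℝ])).add_const (r • iotaSph α β)
  have hρ : HasDerivAt (fun s => pt t s α β) (iotaSph α β) r := by
    simp only [pt_eq]
    simpa using ((hasDerivAt_id r).smul_const (iotaSph α β)).const_add (t • (1 : ℍ[ℝ]))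
  have hA : HasDerivAt (fun s => pt t r s β) (r • iotaA α β) α := by
    simp only [pt_eq]
    exact ((hasDerivAt_iotaSph_left α β).const_smul r).const_add _
  have hB : HasDerivAt (fun s => pt t r α s) (r • iotaB α β) β := by
    simp only [pt_eq]
    exact ((hasDerivAt_iotaSph_right α β).const_smul r).const_add _
  have et := (hL.comp_hasDerivAt t ht).deriv
  have eρ := (hL.comp_hasDerivAt r hρ).deriv
  have eA := (hL.comp_hasDerivAt α hA).deriv
  have eB := (hL.comp_hasDerivAt β hB).deriv
  simp only [Function.comp_def] at et eρ eA eB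
  rw [et, eρ, eA, eB, iotaA_inv, iotaB_inv, Dl, add_assoc, add_assoc, ← add_assoc (qi * _),
    sum_basis_mul_map_eq_sum_spherical _ α hβ]
  simp only [map_smul, mul_smul_comm, ← smul_add, inv_smul_smul₀ hr.ne', neg_mul, smul_mul_assoc]
  abel
end
end
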